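/- Let G be a finitely generated group whose word problem is not co-recursively enumerable (the set of words over the generators representing non-identity elements is not recursively enumerable). Then for every nonempty strongly aperiodic G-subshift X (a subshift on which the shift action is free: g·x = x implies g = 1_G), the Medvedev degree m(X) is not a Π⁰₁ Medvedev degree. -/

import Mathlib

namespace MedvedevFormal

/-! ### Medvedev reducibility on Baire space -/

/-- The finite prefix of length `k` of a point of Baire space, as a list. -/
def pref (x : ℕ → ℕ) (k : ℕ) : List ℕ := (List.range k).map x

/-- Medvedev reducibility `m(P) ≤ m(Q)` between subsets of Baire space: some computable
monotone prefix-functional (i.e. a partial computable type-two functional), defined on all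
of `Q`, maps every element of `Q` to an element of `P`. -/
def BaireLE (P Q : Set (ℕ → ℕ)) : Prop :=
  ∃ φ : List ℕ → List ℕ, Computable φ ∧
    (∀ l₁ l₂ : List ℕ, l₁ <+: l₂ → φ l₁ <+: φ l₂) ∧
    ∀ x ∈ Q, ∃ y ∈ P, ∀ n : ℕ, ∃ k : ℕ, (φ (pref x k))[n]? = some (y n)

/-- Medvedev equivalence: `m(P) = m(Q)`. -/
def BaireEquiv (P Q : Set (ℕ → ℕ)) : Prop := BaireLE P Q ∧ BaireLE Q P

/-- A canonical representative of the join `m(P) ∨ m(Q)`. -/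
def joinSet (P Q : Set (ℕ → ℕ)) : Set (ℕ → ℕ) :=
  {x | (fun n => x (2 * n)) ∈ P ∧ (fun n => x (2 * n + 1)) ∈ Q}

/-- A canonical representative of the meet `m(P) ∧ m(Q)`. -/
def meetSet (P Q : Set (ℕ → ℕ)) : Set (ℕ → ℕ) :=
  {x | (x 0 = 0 ∧ (fun n => x (n + 1)) ∈ P) ∨ (x 0 = 1 ∧ (fun n => x (n + 1)) ∈ Q)}

/-- `P` has the zero Medvedev degree `0_M`: it contains a computable point. -/
def IsZeroDeg (P : Set (ℕ → ℕ)) : Prop := ∃ y ∈ P, Computable y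

/-- The cylinder of a finite word in Baire space. -/
def cylinder (l : List ℕ) : Set (ℕ → ℕ) :=
  {x | ∀ (i : ℕ) (h : i < l.length), x i = l[i]}

/-- Cantor space `{0,1}^ℕ` inside Baire space. -/
def cantorSpace : Set (ℕ → ℕ) := {x | ∀ n, x n ≤ 1}

/-- `P` is an effectively closed (`Π⁰₁`) subset of Cantor space: its complement within
Cantor space is the union of the cylinders of a computably enumerable sequence of words. -/
def IsPi01Cantor (P : Set (ℕ → ℕ)) : Prop :=
  ∃ f : ℕ → List ℕ, Computable f ∧ P = cantorSpace \ ⋃ n, cylinder (f n)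

/-- The Medvedev degree of `P` is a `Π⁰₁` Medvedev degree. -/
def IsPi01Deg (P : Set (ℕ → ℕ)) : Prop :=
  ∃ Q, IsPi01Cantor Q ∧ Q.Nonempty ∧ BaireEquiv P Q

/-- `P` realizes the maximal `Π⁰₁` Medvedev degree (the degree of the class of complete
consistent extensions of Peano arithmetic): it is a nonempty `Π⁰₁` subset of Cantor space
to which every nonempty `Π⁰₁` subset of Cantor space is Medvedev reducible. -/
def IsMaxPi01 (P : Set (ℕ → ℕ)) : Prop :=
  IsPi01Cantor P ∧ P.Nonempty ∧ ∀ Q, IsPi01Cantor Q → Q.Nonempty → BaireLE Q P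

/-! ### Encoding of configuration spaces -/

/-- The canonical encoding of a configuration `x : α → A` as a point of Baire space. -/
def confFun {α A : Type*} [Encodable α] [Encodable A] (x : α → A) : ℕ → ℕ :=
  fun n => Encodable.encode ((Encodable.decode (α := α) n).map x)

/-- The image of a set of configurations in Baire space, used to measure its
Medvedev degree. -/
def mSet {α A : Type*} [Encodable α] [Encodable A] (X : Set (α → A)) : Set (ℕ → ℕ) :=
  confFun '' X

/-- A configuration is computable if its Baire-space encoding is computable. -/
def ComputablePoint {α A : Type*} [Encodable α] [Encodable A] (x : α → A) : Prop :=
  Computable (confFun x)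

/-- `m(X) ≤ m(Y)` for sets of configurations. -/
def MedLE {α A β B : Type*} [Encodable α] [Encodable A] [Encodable β] [Encodable B]
    (X : Set (α → A)) (Y : Set (β → B)) : Prop :=
  BaireLE (mSet X) (mSet Y)

/-- `m(X) = m(Y)` for sets of configurations. -/
def MedEquiv {α A β B : Type*} [Encodable α] [Encodable A] [Encodable β] [Encodable B]
    (X : Set (α → A)) (Y : Set (β → B)) : Prop :=
  MedLE X Y ∧ MedLE Y X

/-! ### Subshifts -/

/-- The left shift action: `(g • x) h = x (g⁻¹ h)`. -/
def shift {G A : Type*} [Group G] (g : G) (x : G → A) : G → A := fun h => x (g⁻¹ * h)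

/-- The prodiscrete topology on `A^G`. -/
def prodiscrete (G A : Type*) : TopologicalSpace (G → A) :=
  @Pi.topologicalSpace G (fun _ => A) fun _ => ⊥

/-- A subshift: a shift-invariant subset of `A^G`, closed in the prodiscrete topology. -/
def IsSubshift {G A : Type*} [Group G] (X : Set (G → A)) : Prop :=
  (∀ x ∈ X, ∀ g : G, shift g x ∈ X) ∧ @IsClosed (G → A) (prodiscrete G A) X

/-- A pattern: a map `p : D → A` with `D ⊆ G` finite. -/
structure Pattern (G A : Type*) where
  dom : Finset G
  val : {g // g ∈ dom} → A

/-- The translate `g • x` agrees with the pattern `p` on its domain. -/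
def MatchesAt {G A : Type*} [Group G] (p : Pattern G A) (g : G) (x : G → A) : Prop :=
  ∀ h : {g' // g' ∈ p.dom}, shift g x h = p.val h

/-- A subshift of finite type: defined by a finite list of forbidden patterns. -/
def IsSFT {G A : Type*} [Group G] (X : Set (G → A)) : Prop :=
  ∃ F : List (Pattern G A), X = {x | ∀ p ∈ F, ∀ g : G, ¬MatchesAt p g x}

/-- A morphism between subshifts: a continuous shift-equivariant map from `X` to `Y`. -/
def IsMorphism {G A B : Type*} [Group G] (X : Set (G → A)) (Y : Set (G → B))
    (φ : (G → A) → (G → B)) : Prop :=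
  Set.MapsTo φ X Y ∧
    @ContinuousOn (G → A) (G → B) (prodiscrete G A) (prodiscrete G B) φ X ∧
    ∀ x ∈ X, ∀ g : G, φ (shift g x) = shift g (φ x)

/-- A sofic subshift: the image of an SFT (on some finite alphabet) under a topological
factor map. -/
def IsSofic {G A : Type*} [Group G] (X : Set (G → A)) : Prop :=
  ∃ (B : Type) (_ : Finite B) (Y : Set (G → B)) (φ : (G → B) → (G → A)),
    IsSFT Y ∧ IsMorphism Y X φ ∧ φ '' Y = X

/-! ### Finitely generated groups, covers and pullbacks -/

/-- `σ` enumerates a finite symmetric generating set of `G`. -/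
def IsSymmGen {G : Type*} [Group G] {k : ℕ} (σ : Fin k → G) : Prop :=
  Subgroup.closure (Set.range σ) = ⊤ ∧ ∀ i, (σ i)⁻¹ ∈ Set.range σ

/-- The canonical encoding of a free group via reduced words. -/
instance freeGroupEncodable {α : Type*} [DecidableEq α] [Encodable α] :
    Encodable (FreeGroup α) :=
  Encodable.ofLeftInjection FreeGroup.toWord (fun l => some (FreeGroup.mk l))
    fun _ => congrArg some FreeGroup.mk_toWord

/-- The canonical homomorphism from the free group determined by `σ`. -/
def cover {G : Type*} [Group G] {k : ℕ} (σ : Fin k → G) : FreeGroup (Fin k) →* G :=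
  FreeGroup.lift σ

/-- The pullback of a subshift along a group homomorphism. -/
def pullback {K G A : Type*} [Group K] [Group G] (ρ : K →* G) (X : Set (G → A)) :
    Set (K → A) :=
  (fun x => x ∘ ρ) '' X

/-- The group element represented by a word over the generators. -/
def wordVal {G : Type*} [Group G] {k : ℕ} (σ : Fin k → G) (w : List (Fin k × Bool)) : G :=
  cover σ (FreeGroup.mk w)

/-- `G` is recursively presented w.r.t. `σ`: its word problem is recursively enumerable. -/
def RecursivelyPresented {G : Type*} [Group G] {k : ℕ} (σ : Fin k → G) : Prop :=
  ∃ f : ℕ → Option (List (Fin k × Bool)), Computable f ∧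
    ∀ w : List (Fin k × Bool), (wordVal σ w = 1 ↔ ∃ n, f n = some w)

/-- The membership problem of the subgroup `H` in `G` is decidable w.r.t. `σ`. -/
def DecidableMembership {G : Type*} [Group G] {k : ℕ} (σ : Fin k → G)
    (H : Subgroup G) : Prop :=
  ∃ φ : List (Fin k × Bool) → Bool, Computable φ ∧
    ∀ w : List (Fin k × Bool), (φ w = true ↔ wordVal σ w ∈ H)

/-- `G` has decidable word problem w.r.t. `σ`. -/
def DecidableWordProblem {G : Type*} [Group G] {k : ℕ} (σ : Fin k → G) : Prop :=
  ∃ φ : List (Fin k × Bool) → Bool, Computable φ ∧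
    ∀ w : List (Fin k × Bool), (φ w = true ↔ wordVal σ w = 1)

/-- The set of configurations on the free group matching a coded pattern: a pattern is
coded as a list of pairs (code of a group element, code of a letter). -/
def codedCylinder {k : ℕ} {A : Type*} [Encodable A] (p : List (ℕ × ℕ)) :
    Set (FreeGroup (Fin k) → A) :=
  {x | ∀ q ∈ p, ∀ g : FreeGroup (Fin k),
    Encodable.encode g = q.1 → Encodable.encode (x g) = q.2}

/-- `X` is an effective subshift: the complement of its pullback to the free group is the
union of the cylinders of a computably enumerable sequence of finitely supported patterns. -/
def IsEffective {G : Type*} [Group G] {k : ℕ} (σ : Fin k → G) {A : Type*} [Encodable A]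
    (X : Set (G → A)) : Prop :=
  ∃ f : ℕ → List (ℕ × ℕ), Computable f ∧
    (pullback (cover σ) X)ᶜ = ⋃ n, codedCylinder (f n)

/-! ### Degree spectra -/

/-- The Medvedev degree of `P` belongs to `M_SFT(G)`: some nonempty `G`-SFT has the
Medvedev degree of `P`. -/
def IsSFTDeg {G : Type*} [Group G] {k : ℕ} (σ : Fin k → G) (P : Set (ℕ → ℕ)) : Prop :=
  ∃ (n : ℕ) (X : Set (G → Fin n)), IsSFT X ∧ X.Nonempty ∧
    BaireEquiv (mSet (pullback (cover σ) X)) P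

/-- The Medvedev degree of `P` belongs to `M_sof(G)`. -/
def IsSoficDeg {G : Type*} [Group G] {k : ℕ} (σ : Fin k → G) (P : Set (ℕ → ℕ)) : Prop :=
  ∃ (n : ℕ) (X : Set (G → Fin n)), IsSofic X ∧ X.Nonempty ∧
    BaireEquiv (mSet (pullback (cover σ) X)) P

/-- The Medvedev degree of `P` belongs to `M_eff(G)`. -/
def IsEffDeg {G : Type*} [Group G] {k : ℕ} (σ : Fin k → G) (P : Set (ℕ → ℕ)) : Prop :=
  ∃ (n : ℕ) (X : Set (G → Fin n)), IsSubshift X ∧ IsEffective σ X ∧ X.Nonempty ∧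
    BaireEquiv (mSet (pullback (cover σ) X)) P

/-! ### Word metrics and quasi-isometries -/

/-- The word length of `g` w.r.t. the (symmetric) generating map `σ`. -/
noncomputable def wordNorm {G : Type*} [Group G] {k : ℕ} (σ : Fin k → G) (g : G) : ℕ :=
  sInf {n | ∃ w : List (Fin k), w.length = n ∧ (w.map σ).prod = g}

/-- The word metric on `G` w.r.t. `σ`, as a real number. -/
noncomputable def wordDist {G : Type*} [Group G] {k : ℕ} (σ : Fin k → G) (g g' : G) : ℝ :=
  (wordNorm σ (g⁻¹ * g') : ℝ)

/-- `f : G → H` is a quasi-isometry w.r.t. the word metrics given by `σ` and `τ`. -/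
def IsQIGroups {G H : Type*} [Group G] [Group H] {k r : ℕ} (σ : Fin k → G)
    (τ : Fin r → H) (f : G → H) : Prop :=
  ∃ C : ℝ, 1 ≤ C ∧
    (∀ g g' : G, (1 / C) * wordDist σ g g' - C ≤ wordDist τ (f g) (f g') ∧
      wordDist τ (f g) (f g') ≤ C * wordDist σ g g' + C) ∧
    ∀ h : H, ∃ g : G, wordDist τ h (f g) ≤ C

/-- `f : G → Y` is a quasi-isometry from the group `G` (with word metric from `σ`) to the
metric space `Y`. -/
def IsQIToSpace {G : Type*} [Group G] {k : ℕ} (σ : Fin k → G) {Y : Type*}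
    [MetricSpace Y] (f : G → Y) : Prop :=
  ∃ C : ℝ, 1 ≤ C ∧
    (∀ g g' : G, (1 / C) * wordDist σ g g' - C ≤ dist (f g) (f g') ∧
      dist (f g) (f g') ≤ C * wordDist σ g g' + C) ∧
    ∀ y : Y, ∃ g : G, dist y (f g) ≤ C

/-- `f : G → H` is computable w.r.t. the generating maps `σ` and `τ`: some computable map
on words sends each word representing `g` to a word representing `f g`. -/
def ComputableMap {G H : Type*} [Group G] [Group H] {k r : ℕ} (σ : Fin k → G)
    (τ : Fin r → H) (f : G → H) : Prop :=
  ∃ φ : List (Fin k × Bool) → List (Fin r × Bool), Computable φ ∧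
    ∀ w : List (Fin k × Bool), wordVal τ (φ w) = f (wordVal σ w)

/-! ### Bounded quantifiers over computable predicates -/

theorem computable_all_range {α : Type*} [Primcodable α] {b : α → ℕ} {p : α → ℕ → Bool}
    (hb : Computable b) (hp : Computable₂ p) :
    Computable fun a => (List.range (b a)).all (p a) := by
  have h : Computable fun a =>
      Nat.rec (motive := fun _ => Bool) true (fun n acc => acc && p a n) (b a) :=
    Computable.nat_rec (h := fun a q => q.2 && p a q.1) hb (Computable.const true)
      (Primrec.and.to_comp.comp (Computable.snd.comp Computable.snd)
        (hp.comp Computable.fst (Computable.fst.comp Computable.snd)))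
  refine h.of_eq fun a => ?_
  induction b a with
  | zero => rfl
  | succ n ih => simp [List.range_succ, ← ih]

theorem computable_any_range {α : Type*} [Primcodable α] {b : α → ℕ} {p : α → ℕ → Bool}
    (hb : Computable b) (hp : Computable₂ p) :
    Computable fun a => (List.range (b a)).any (p a) := by
  have h := Primrec.not.to_comp.comp
    (computable_all_range hb (p := fun a n => !p a n) (Primrec.not.to_comp.comp hp))
  refine h.of_eq fun a => ?_
  simp [List.all_eq_not_any_not]

/-! ### Binary words of bounded length -/

theorem length_pref (x : ℕ → ℕ) (n : ℕ) : (pref x n).length = n := by simp [pref]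

theorem pref_congr {x y : ℕ → ℕ} {n : ℕ} (h : ∀ i < n, x i = y i) : pref x n = pref y n :=
  List.map_congr_left fun i hi => h i (List.mem_range.1 hi)

theorem pref_mono (x : ℕ → ℕ) {m n : ℕ} (h : m ≤ n) : pref x m <+: pref x n := by
  obtain ⟨d, rfl⟩ := Nat.exists_eq_add_of_le h
  simp [pref, List.range_add]

theorem pref_eq_iff_mem_cylinder {x : ℕ → ℕ} {l : List ℕ} :
    pref x l.length = l ↔ x ∈ cylinder l := by
  constructor
  · intro h i hi
    have := List.getElem_of_eq h (i := i) (by simpa [pref] using hi)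
    simpa [pref] using this
  · intro h
    refine List.ext_getElem (length_pref _ _) fun i h₁ h₂ => ?_
    simpa [pref] using h i h₂

/-- The sequence of binary digits of a natural number. -/
def digitSeq (m i : ℕ) : ℕ := m / 2 ^ i % 2

theorem primrec_pow : Primrec₂ ((· ^ ·) : ℕ → ℕ → ℕ) :=
  Primrec₂.unpaired'.1 Nat.Primrec.pow

theorem primrec_pref_digitSeq : Primrec₂ fun m n => pref (digitSeq m) n := by
  refine Primrec.list_map (Primrec.list_range.comp Primrec.snd) ?_
  exact Primrec.nat_mod.comp
    (Primrec.nat_div.comp (Primrec.fst.comp Primrec.fst)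
      (primrec_pow.comp (Primrec.const 2) Primrec.snd)) (Primrec.const 2)

theorem digitSeq_mem_cantorSpace (m : ℕ) : digitSeq m ∈ cantorSpace := fun i => by
  have := Nat.mod_lt (m / 2 ^ i) (y := 2) (by norm_num)
  simp only [digitSeq]
  omega

theorem exists_digitSeq {x : ℕ → ℕ} (hx : x ∈ cantorSpace) (N : ℕ) :
    ∃ m < 2 ^ N, ∀ i < N, digitSeq m i = x i := by
  refine ⟨Nat.ofBits fun i : Fin N => decide (x i = 1), Nat.ofBits_lt_two_pow _,
    fun i hi => ?_⟩
  have h := Nat.testBit_ofBits_lt (fun i : Fin N => decide (x i = 1)) i hi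
  rw [Nat.testBit_eq_decide_div_mod_eq, decide_eq_decide] at h
  have h₁ := hx i
  have h₂ := digitSeq_mem_cantorSpace (Nat.ofBits fun i : Fin N => decide (x i = 1)) i
  simp only [digitSeq] at h h₂ ⊢
  omega

/-- Compactness of Cantor space: if for every `N` some point of Cantor space avoids a family
of properties decreasing in `N` and depending on the first `N` coordinates only, then a single
point does so for all `N`. -/
theorem exists_mem_cantorSpace_forall {R : ℕ → (ℕ → ℕ) → Prop}
    (hmono : ∀ N x, R (N + 1) x → R N x)
    (hloc : ∀ N x y, (∀ i < N, x i = y i) → R N x → R N y)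
    (hex : ∀ N, ∃ x ∈ cantorSpace, R N x) :
    ∃ x ∈ cantorSpace, ∀ N, R N x := by
  let t : ℕ → Set (ℕ → Bool) := fun N => {b | R N fun i => (b i).toNat}
  have hclosed : ∀ N, IsClosed (t N) := fun N => by
    have hpre : t N = (fun (b : ℕ → Bool) (i : Fin N) => b i) ⁻¹'
        ((fun (b : ℕ → Bool) (i : Fin N) => b i) '' t N) := by
      refine Set.Subset.antisymm (Set.subset_preimage_image _ _) ?_
      rintro b ⟨c, hc, hcb⟩
      refine hloc N _ _ (fun i hi => ?_) hc
      have := congrFun hcb ⟨i, hi⟩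
      simp only at this
      rw [this]
    rw [hpre]
    exact (isClosed_discrete _).preimage (by fun_prop)
  obtain ⟨b, hb⟩ := IsCompact.nonempty_iInter_of_sequence_nonempty_isCompact_isClosed t
    (fun N b hb => hmono N _ hb)
    (fun N => by
      obtain ⟨x, hx, hR⟩ := hex N
      refine ⟨fun i => decide (x i = 1), hloc N _ _ (fun i _ => ?_) hR⟩
      have := hx i
      by_cases h : x i = 1
      · simp [h]
      · simp [h]; omega)
    (hclosed 0).isCompact hclosed
  exact ⟨fun i => (b i).toNat, fun i => Bool.toNat_le _, fun N => Set.mem_iInter.1 hb N⟩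

/-! ### Detecting non-trivial words -/

theorem confFun_encode_word {α A : Type*} [DecidableEq α] [Encodable α] [Encodable A]
    (x : FreeGroup α → A) (l : List (α × Bool)) :
    confFun x (Encodable.encode l) = Encodable.encode (some (x (FreeGroup.mk l))) := by
  have h : (Encodable.decode (α := FreeGroup α) (Encodable.encode l)) =
      some (FreeGroup.mk l) := by
    change (Encodable.decode (α := List (α × Bool)) (Encodable.encode l)).bind
      (fun l => some (FreeGroup.mk l)) = _
    rw [Encodable.encodek]; rfl
  simp [confFun, h]

theorem cover_surjective {G : Type*} [Group G] {k : ℕ} {σ : Fin k → G} (hσ : IsSymmGen σ) :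
    Function.Surjective (cover σ) := by
  rw [← MonoidHom.range_eq_top, cover, FreeGroup.range_lift_eq_closure, hσ.1]

theorem wordVal_append {G : Type*} [Group G] {k : ℕ} (σ : Fin k → G)
    (v w : List (Fin k × Bool)) : wordVal σ (v ++ w) = wordVal σ v * wordVal σ w := by
  simp [wordVal, ← FreeGroup.mul_mk]

theorem wordVal_ne_one_iff {G A : Type*} [Group G] [Encodable A] {k : ℕ} {σ : Fin k → G}
    (hσ : IsSymmGen σ) {X : Set (G → A)} (hap : ∀ x ∈ X, ∀ g : G, shift g x = x → g = 1)
    {y : ℕ → ℕ} (hy : y ∈ mSet (pullback (cover σ) X)) (w : List (Fin k × Bool)) :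
    wordVal σ w ≠ 1 ↔
      ∃ v : List (Fin k × Bool), y (Encodable.encode v) ≠ y (Encodable.encode (w ++ v)) := by
  obtain ⟨_, ⟨x, hx, rfl⟩, rfl⟩ := hy
  have key : ∀ v, confFun (x ∘ cover σ) (Encodable.encode v) =
      Encodable.encode (some (x (wordVal σ v))) := fun v => confFun_encode_word _ v
  simp only [key, wordVal_append, ne_eq, Encodable.encode_inj, Option.some.injEq]
  constructor
  · intro hw
    by_contra! h
    refine hw (inv_eq_one.1 (hap x hx _ (funext fun g => ?_)))
    obtain ⟨u, rfl⟩ := cover_surjective hσ g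
    have hu : cover σ u = wordVal σ u.toWord := by rw [wordVal, FreeGroup.mk_toWord]
    rw [shift, inv_inv, hu]
    exact (h u.toWord).symm
  · rintro ⟨v, hv⟩ hw
    exact hv (by rw [hw, one_mul])

/-- The index `j` witnesses that the finite word `pref x N` either leaves the `Π⁰₁` class
with complement enumerated by `f`, or has an image under `φ` on which translation by `w`
acts non-trivially. -/
def IsWitness {k : ℕ} (f : ℕ → List ℕ) (φ : List ℕ → List ℕ) (w : List (Fin k × Bool))
    (N : ℕ) (x : ℕ → ℕ) (j : ℕ) : Prop :=
  ((f j).length ≤ N ∧ pref x (f j).length = f j) ∨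
    ∃ v : List (Fin k × Bool), Encodable.decode j = some v ∧
      ∃ a ∈ (φ (pref x N))[Encodable.encode v]?,
        ∃ b ∈ (φ (pref x N))[Encodable.encode (w ++ v)]?, a ≠ b

theorem IsWitness.congr {k : ℕ} {f : ℕ → List ℕ} {φ : List ℕ → List ℕ}
    {w : List (Fin k × Bool)} {N : ℕ} {x y : ℕ → ℕ} {j : ℕ}
    (hxy : ∀ i < N, x i = y i) (h : IsWitness f φ w N x j) : IsWitness f φ w N y j := by
  rcases h with ⟨hl, h⟩ | h
  · exact Or.inl ⟨hl, by rw [← pref_congr fun i hi => hxy i (hi.trans_le hl), h]⟩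
  · exact Or.inr (by rwa [← pref_congr hxy])

theorem getElem?_mono {φ : List ℕ → List ℕ} (hφ : ∀ l₁ l₂ : List ℕ, l₁ <+: l₂ → φ l₁ <+: φ l₂)
    {x : ℕ → ℕ} {M N n a : ℕ} (h : M ≤ N) (ha : (φ (pref x M))[n]? = some a) :
    (φ (pref x N))[n]? = some a := by
  obtain ⟨t, ht⟩ := hφ _ _ (pref_mono x h)
  rw [← ht, List.getElem?_append_left (List.getElem?_eq_some_iff.1 ha).1, ha]

theorem IsWitness.mono {k : ℕ} {f : ℕ → List ℕ} {φ : List ℕ → List ℕ}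
    (hφ : ∀ l₁ l₂ : List ℕ, l₁ <+: l₂ → φ l₁ <+: φ l₂)
    {w : List (Fin k × Bool)} {M N : ℕ} {x : ℕ → ℕ} {j : ℕ} (hMN : M ≤ N)
    (h : IsWitness f φ w M x j) : IsWitness f φ w N x j := by
  rcases h with ⟨hl, h⟩ | ⟨v, hv, a, ha, b, hb, hab⟩
  · exact Or.inl ⟨hl.trans hMN, h⟩
  · exact Or.inr ⟨v, hv, a, getElem?_mono hφ hMN ha, b, getElem?_mono hφ hMN hb, hab⟩

theorem exists_computable_isWitness {k : ℕ} {f : ℕ → List ℕ} {φ : List ℕ → List ℕ}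
    (hf : Computable f) (hφ : Computable φ) :
    ∃ E : (List (Fin k × Bool) × ℕ) × ℕ → ℕ → Bool, Computable₂ E ∧
      ∀ w N m j, E ((w, N), m) j = true ↔ IsWitness f φ w N (digitSeq m) j := by
  let E₁ : ((List (Fin k × Bool) × ℕ) × ℕ) × ℕ → Bool := fun p =>
    decide ((f p.2).length ≤ p.1.1.2) &&
      decide (pref (digitSeq p.1.2) (f p.2).length = f p.2)
  let E₂ : ((List (Fin k × Bool) × ℕ) × ℕ) × ℕ → Bool := fun p =>
    ((Encodable.decode (α := List (Fin k × Bool)) p.2).bind fun v =>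
      ((φ (pref (digitSeq p.1.2) p.1.1.2))[Encodable.encode v]?).bind fun a =>
        ((φ (pref (digitSeq p.1.2) p.1.1.2))[Encodable.encode (p.1.1.1 ++ v)]?).map fun b =>
          !decide (a = b)).getD false
  have hm : Computable fun p : ((List (Fin k × Bool) × ℕ) × ℕ) × ℕ => p.1.2 :=
    Computable.snd.comp Computable.fst
  have hN : Computable fun p : ((List (Fin k × Bool) × ℕ) × ℕ) × ℕ => p.1.1.2 :=
    Computable.snd.comp (Computable.fst.comp Computable.fst)
  have hw : Computable fun p : ((List (Fin k × Bool) × ℕ) × ℕ) × ℕ => p.1.1.1 :=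
    Computable.fst.comp (Computable.fst.comp Computable.fst)
  have hfj : Computable fun p : ((List (Fin k × Bool) × ℕ) × ℕ) × ℕ => f p.2 :=
    hf.comp Computable.snd
  have hlen : Computable fun p : ((List (Fin k × Bool) × ℕ) × ℕ) × ℕ => (f p.2).length :=
    Computable.list_length.comp hfj
  have hE₁ : Computable E₁ :=
    Primrec.and.to_comp.comp (Primrec.nat_le.decide.to_comp.comp hlen hN)
      (Primrec.eq.decide.to_comp.comp (primrec_pref_digitSeq.to_comp.comp hm hlen) hfj)
  have hφx : Computable fun p : ((List (Fin k × Bool) × ℕ) × ℕ) × ℕ =>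
      φ (pref (digitSeq p.1.2) p.1.1.2) :=
    hφ.comp (primrec_pref_digitSeq.to_comp.comp hm hN)
  have hE₂ : Computable E₂ := by
    refine Computable.option_getD (Computable.option_bind
      (Computable.decode.comp Computable.snd) ?_) (Computable.const false)
    refine Computable.option_bind (Computable.list_getElem?.comp (hφx.comp Computable.fst)
      (Computable.encode.comp Computable.snd)) ?_
    refine Computable.option_map (Computable.list_getElem?.comp
      (hφx.comp (Computable.fst.comp Computable.fst))
      (Computable.encode.comp (Computable.list_append.comp
        (hw.comp (Computable.fst.comp Computable.fst))
        (Computable.snd.comp Computable.fst)))) ?_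
    exact Primrec.not.to_comp.comp (Primrec.eq.decide.to_comp.comp
      (Computable.snd.comp Computable.fst) Computable.snd)
  refine ⟨fun q j => E₁ (q, j) || E₂ (q, j), Primrec.or.to_comp.comp hE₁ hE₂,
    fun w N m j => ?_⟩
  simp only [E₁, E₂, IsWitness, Bool.or_eq_true, Bool.and_eq_true, decide_eq_true_eq]
  refine or_congr Iff.rfl ?_
  simp [Option.getD_eq_iff, Option.bind_eq_some_iff]

theorem exists_forall_isWitness_iff {G A : Type*} [Group G] [Encodable A] {k : ℕ}
    {σ : Fin k → G} (hσ : IsSymmGen σ) {X : Set (G → A)}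
    (hap : ∀ x ∈ X, ∀ g : G, shift g x = x → g = 1)
    {f : ℕ → List ℕ} {φ : List ℕ → List ℕ}
    (hφ : ∀ l₁ l₂ : List ℕ, l₁ <+: l₂ → φ l₁ <+: φ l₂)
    (hne : (cantorSpace \ ⋃ n, cylinder (f n)).Nonempty)
    (hmaps : ∀ x ∈ cantorSpace \ ⋃ n, cylinder (f n), ∃ y ∈ mSet (pullback (cover σ) X),
      ∀ n : ℕ, ∃ k : ℕ, (φ (pref x k))[n]? = some (y n))
    (w : List (Fin k × Bool)) :
    wordVal σ w ≠ 1 ↔ ∃ N, ∀ m < 2 ^ N, ∃ j < N, IsWitness f φ w N (digitSeq m) j := by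
  constructor
  · intro hw
    by_contra! h
    obtain ⟨x, hxc, hx⟩ := exists_mem_cantorSpace_forall
      (R := fun N x => ∀ j < N, ¬IsWitness f φ w N x j)
      (fun N x h j hj hwit => h j (by omega) (hwit.mono hφ N.le_succ))
      (fun N x y hxy h j hj hwit => h j hj (hwit.congr fun i hi => (hxy i hi).symm))
      (fun N => by
        obtain ⟨m, -, hm⟩ := h N
        exact ⟨digitSeq m, digitSeq_mem_cantorSpace m, hm⟩)
    have hxQ : x ∈ cantorSpace \ ⋃ n, cylinder (f n) := by
      refine ⟨hxc, fun hmem => ?_⟩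
      obtain ⟨n, hn⟩ := Set.mem_iUnion.1 hmem
      exact hx (max (n + 1) (f n).length) n (by simp)
        (Or.inl ⟨by simp, pref_eq_iff_mem_cylinder.2 hn⟩)
    obtain ⟨y, hy, hyφ⟩ := hmaps x hxQ
    obtain ⟨v, hv⟩ := (wordVal_ne_one_iff hσ hap hy w).1 hw
    obtain ⟨k₁, h₁⟩ := hyφ (Encodable.encode v)
    obtain ⟨k₂, h₂⟩ := hyφ (Encodable.encode (w ++ v))
    exact hx (Encodable.encode v + 1 + k₁ + k₂) (Encodable.encode v) (by omega)
      (Or.inr ⟨v, Encodable.encodek v, _, getElem?_mono hφ (by omega) h₁,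
        _, getElem?_mono hφ (by omega) h₂, hv⟩)
  · rintro ⟨N, hN⟩
    obtain ⟨x, hx⟩ := hne
    obtain ⟨y, hy, hyφ⟩ := hmaps x hx
    obtain ⟨m, hm, hmx⟩ := exists_digitSeq hx.1 N
    obtain ⟨j, -, hj⟩ := hN m hm
    rcases hj.congr hmx with ⟨-, h⟩ | ⟨v, -, a, ha, b, hb, hab⟩
    · exact absurd (Set.mem_iUnion.2 ⟨j, pref_eq_iff_mem_cylinder.1 h⟩) hx.2
    · refine (wordVal_ne_one_iff hσ hap hy w).2 ⟨v, fun hv => hab ?_⟩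
      have hval : ∀ {n c : ℕ}, (φ (pref x N))[n]? = some c → c = y n := fun {n c} hc => by
        obtain ⟨K, hK⟩ := hyφ n
        have h₁ := getElem?_mono hφ (le_max_left N K) hc
        have h₂ := getElem?_mono hφ (le_max_right N K) hK
        exact Option.some.inj (h₁.symm.trans h₂)
      rw [hval ha, hval hb, hv]

/-- If the word problem of `G` is not co-recursively enumerable, then every nonempty
strongly aperiodic `G`-subshift has a Medvedev degree which is not a `Π⁰₁` Medvedev
degree. -/
theorem statement19 {G : Type*} [Group G] {A : Type*} [Finite A] [Encodable A]
    {k : ℕ} (σ : Fin k → G) (hσ : IsSymmGen σ)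
    (hwp : ¬∃ f : ℕ → Option (List (Fin k × Bool)), Computable f ∧
      ∀ w : List (Fin k × Bool), (wordVal σ w ≠ 1 ↔ ∃ n, f n = some w))
    (X : Set (G → A)) (hX : IsSubshift X) (hne : X.Nonempty)
    (hap : ∀ x ∈ X, ∀ g : G, shift g x = x → g = 1) :
    ¬IsPi01Deg (mSet (pullback (cover σ) X)) := by
  rintro ⟨_, ⟨f, hf, rfl⟩, hQne, ⟨φ, hφc, hφ, hmaps⟩, -⟩
  obtain ⟨E, hE, hEspec⟩ := exists_computable_isWitness (k := k) hf hφc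
  let C : List (Fin k × Bool) × ℕ → Bool := fun p =>
    (List.range (2 ^ p.2)).all fun m => (List.range p.2).any fun j => E (p, m) j
  have hC : Computable C :=
    computable_all_range (primrec_pow.to_comp.comp (Computable.const 2) Computable.snd)
      (computable_any_range (Computable.snd.comp Computable.fst) hE)
  have hCspec : ∀ w, wordVal σ w ≠ 1 ↔ ∃ N, C (w, N) = true := fun w => by
    rw [exists_forall_isWitness_iff hσ hap hφ hQne hmaps w]
    simp [C, hEspec]
  refine hwp ⟨fun n => (Encodable.decode (α := List (Fin k × Bool) × ℕ) n).bind fun p =>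
    cond (C p) (some p.1) none, ?_, fun w => ?_⟩
  · exact Computable.option_bind Computable.decode
      (Computable.cond (hC.comp Computable.snd)
        (Computable.option_some.comp (Computable.fst.comp Computable.snd))
        (Computable.const none))
  · rw [hCspec]
    constructor
    · rintro ⟨N, hN⟩
      exact ⟨Encodable.encode (w, N), by simp only [Encodable.encodek]; simp [hN]⟩
    · rintro ⟨n, hn⟩
      obtain ⟨⟨v, N⟩, -, h⟩ := Option.bind_eq_some_iff.1 hn
      cases hCv : C (v, N) with
      | false => simp [hCv] at h
      | true =>
        simp only [hCv, cond_true, Option.some.injEq] at h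
        exact ⟨N, h ▸ hCv⟩

end MedvedevFormal
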